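/- arXiv:1212.6466 — 2 statements merged into one kernel-verified Lean document; each statement's English description precedes it below -/
import Mathlib

section
/- Let G be a 2-connected graph. If G contains no induced subgraph isomorphic to K_{1,3} and no induced subgraph isomorphic to Z_2, then G is Hamiltonian. -/
open SimpleGraph

/-- `G` is 2-connected: at least 3 vertices and deleting any single vertex leaves
a connected graph. -/
def TwoConnected {V : Type*} [Fintype V] (G : SimpleGraph V) : Prop :=
  3 ≤ Fintype.card V ∧ ∀ v : V, (G.induce {w | w ≠ v}).Connected

/-- `c, a, b, d` form an induced claw (`K_{1,3}`) in `G` with center `c` and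
end-vertices `a`, `b`, `d`. -/
def IsInducedClaw {V : Type*} (G : SimpleGraph V) (c a b d : V) : Prop :=
  a ≠ b ∧ a ≠ d ∧ b ≠ d ∧
  G.Adj c a ∧ G.Adj c b ∧ G.Adj c d ∧
  ¬G.Adj a b ∧ ¬G.Adj a d ∧ ¬G.Adj b d

/-- `a₁, a₂, a₃, b₁` form an induced copy of `Z₁` in `G`: triangle `a₁a₂a₃` with
pendant edge `a₁b₁`. -/
def IsInducedZ1 {V : Type*} (G : SimpleGraph V) (a1 a2 a3 b1 : V) : Prop :=
  G.Adj a1 a2 ∧ G.Adj a1 a3 ∧ G.Adj a2 a3 ∧ G.Adj a1 b1 ∧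
  b1 ≠ a2 ∧ b1 ≠ a3 ∧ ¬G.Adj b1 a2 ∧ ¬G.Adj b1 a3

/-- `a₁, a₂, a₃, b₁, c₁` form an induced copy of `Z₂` in `G`: triangle `a₁a₂a₃`
with path `a₁b₁c₁` attached at `a₁`. -/
def IsInducedZ2 {V : Type*} (G : SimpleGraph V) (a1 a2 a3 b1 c1 : V) : Prop :=
  G.Adj a1 a2 ∧ G.Adj a1 a3 ∧ G.Adj a2 a3 ∧ G.Adj a1 b1 ∧ G.Adj b1 c1 ∧
  b1 ≠ a2 ∧ b1 ≠ a3 ∧ c1 ≠ a1 ∧ c1 ≠ a2 ∧ c1 ≠ a3 ∧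
  ¬G.Adj b1 a2 ∧ ¬G.Adj b1 a3 ∧ ¬G.Adj c1 a1 ∧ ¬G.Adj c1 a2 ∧ ¬G.Adj c1 a3

theorem SimpleGraph.Connected.exists_adj_of_induce_ne {V : Type*} {G : SimpleGraph V} {v a b : V}
    (h : (G.induce {w | w ≠ v}).Connected) {P : V → Prop} (hav : a ≠ v) (hbv : b ≠ v)
    (ha : P a) (hb : ¬P b) :
    ∃ y z, G.Adj y z ∧ y ≠ v ∧ z ≠ v ∧ P y ∧ ¬P z := by
  obtain ⟨p⟩ := h.preconnected ⟨a, hav⟩ ⟨b, hbv⟩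
  obtain ⟨d, -, hd1, hd2⟩ := p.exists_boundary_dart {x | P x} ha hb
  exact ⟨d.fst, d.snd, d.adj, d.fst.2, d.snd.2, hd1, hd2⟩

/-- `G` has a walk from `a` to `b` whose vertices, with multiplicity, are `s`. -/
inductive Traverse {V : Type*} (G : SimpleGraph V) : V → V → Multiset V → Prop
  | single (v : V) : Traverse G v v {v}
  | join {a b c d : V} {s t : Multiset V} :
      Traverse G a b s → G.Adj b c → Traverse G c d t → Traverse G a d (s + t)

namespace Traverse

variable {V : Type*} {G : SimpleGraph V} {a b v : V} {s : Multiset V}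

theorem symm (h : Traverse G a b s) : Traverse G b a s := by
  induction h with
  | single v => exact single v
  | join _ hbc _ ih₁ ih₂ => rw [add_comm]; exact ih₂.join hbc.symm ih₁

theorem right_mem (h : Traverse G a b s) : b ∈ s := by
  induction h <;> simp_all

theorem left_mem (h : Traverse G a b s) : a ∈ s := h.symm.right_mem

theorem cons (hva : G.Adj v a) (h : Traverse G a b s) : Traverse G v b (v ::ₘ s) :=
  (single v).join hva h

theorem split (h : Traverse G a b s) (hv : v ∈ s) :
    ∃ s₁, Traverse G a v s₁ ∧
      (s = s₁ ∧ v = b ∨ ∃ c s₂, s = s₁ + s₂ ∧ G.Adj v c ∧ Traverse G c b s₂) := by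
  induction h with
  | single u =>
    obtain rfl := Multiset.mem_singleton.mp hv
    exact ⟨_, single v, .inl ⟨rfl, rfl⟩⟩
  | join h₁ hbc h₂ ih₁ ih₂ =>
    rcases Multiset.mem_add.mp hv with hv | hv
    · obtain ⟨s₁, hs₁, ⟨rfl, rfl⟩ | ⟨e, s₂, rfl, hve, hs₂⟩⟩ := ih₁ hv
      · exact ⟨_, hs₁, .inr ⟨_, _, rfl, hbc, h₂⟩⟩
      · exact ⟨s₁, hs₁, .inr ⟨e, _, add_assoc .., hve, hs₂.join hbc h₂⟩⟩
    · obtain ⟨t₁, ht₁, ⟨rfl, rfl⟩ | ⟨e, t₂, rfl, hve, ht₂⟩⟩ := ih₂ hv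
      · exact ⟨_, h₁.join hbc ht₁, .inl ⟨rfl, rfl⟩⟩
      · exact ⟨_, h₁.join hbc ht₁, .inr ⟨e, t₂, (add_assoc ..).symm, hve, ht₂⟩⟩

theorem eq_singleton_or_cons (h : Traverse G a b s) :
    s = {a} ∧ a = b ∨ ∃ c t, s = a ::ₘ t ∧ G.Adj a c ∧ Traverse G c b t := by
  induction h with
  | single v => exact .inl ⟨rfl, rfl⟩
  | join h₁ hbc h₂ ih₁ _ =>
    right
    obtain ⟨rfl, rfl⟩ | ⟨e, t, rfl, hae, ht⟩ := ih₁
    · exact ⟨_, _, rfl, hbc, h₂⟩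
    · exact ⟨e, _, by simp, hae, ht.join hbc h₂⟩

theorem exists_walk (h : Traverse G a b s) :
    ∃ p : G.Walk a b, (p.support : Multiset V) = s := by
  induction h with
  | single v => exact ⟨.nil, rfl⟩
  | join _ hbc _ ih₁ ih₂ =>
    obtain ⟨p, rfl⟩ := ih₁
    obtain ⟨q, rfl⟩ := ih₂
    exact ⟨p.append (.cons hbc q), by simp [Walk.support_append]⟩

/-- Cyclic traversals can be started at any vertex. -/
theorem rotate (h : Traverse G a b s) (hba : G.Adj b a) (hv : v ∈ s) :
    ∃ c, G.Adj v c ∧ Traverse G c v s := by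
  obtain ⟨s₁, hs₁, ⟨rfl, rfl⟩ | ⟨c, s₂, rfl, hvc, hs₂⟩⟩ := h.split hv
  · exact ⟨a, hba, hs₁⟩
  · exact ⟨c, hvc, add_comm s₁ s₂ ▸ hs₂.join hba hs₁⟩

/-- A cyclic traversal is a vertex together with a traversal between two of its neighbours. -/
theorem exists_erase (h : Traverse G a b s) (hba : G.Adj b a) (hv : v ∈ s) :
    ∃ c d t, s = v ::ₘ t ∧ G.Adj v c ∧ G.Adj d v ∧ Traverse G c d t := by
  obtain ⟨c, hvc, hc⟩ := h.rotate hba hv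
  obtain ⟨-, rfl⟩ | ⟨d, t, rfl, hvd, hd⟩ := hc.symm.eq_singleton_or_cons
  · exact (G.loopless.irrefl _ hvc).elim
  · exact ⟨c, d, t, rfl, hvc, hvd.symm, hd.symm⟩

variable {c d w x : V} {t P Q : Multiset V}

/-- An outside vertex adjacent to `v` is adjacent to neither cycle neighbour of `v`, when the
cycle cannot be extended by it. -/
theorem not_adj_of_maximal (hclaw : ∀ c a b d : V, ¬IsInducedClaw G c a b d)
    (hno : ∀ e f, Traverse G e f (x ::ₘ v ::ₘ t) → ¬G.Adj f e)
    (ht : Traverse G c d t) (hvc : G.Adj v c) (hdv : G.Adj d v) (hcd : c ≠ d)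
    (hxv : G.Adj x v) (hx : x ∉ t) : ¬G.Adj x c ∧ ¬G.Adj x d ∧ G.Adj c d := by
  have hxc : ¬G.Adj x c := by
    refine hno _ _ ?_
    convert ht.join hdv ((single x).cons hxv.symm) using 1
    simp only [← Multiset.singleton_add]; abel
  have hxd : ¬G.Adj x d := by
    refine hno _ _ ?_
    convert ht.symm.join hvc.symm ((single x).cons hxv.symm) using 1
    simp only [← Multiset.singleton_add]; abel
  refine ⟨hxc, hxd, ?_⟩
  by_contra h
  exact hclaw v x c d ⟨fun h ↦ hx (h ▸ ht.left_mem), fun h ↦ hx (h ▸ ht.right_mem), hcd,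
    hxv.symm, hvc, hdv.symm, hxc, hxd, h⟩

/-- A cycle `v P w Q` together with an outside vertex `x` adjacent to `v` and `w` can be extended. -/
theorem false_of_two_neighbors (hclaw : ∀ c a b d : V, ¬IsInducedClaw G c a b d)
    (hZ2 : ∀ a1 a2 a3 b1 c1 : V, ¬IsInducedZ2 G a1 a2 a3 b1 c1)
    (hno : ∀ e f, Traverse G e f (x ::ₘ v ::ₘ w ::ₘ (P + Q)) → ¬G.Adj f e)
    (hnd : (x ::ₘ v ::ₘ w ::ₘ (P + Q)).Nodup)
    (hP : Traverse G a b P) (hQ : Traverse G c d Q) (hva : G.Adj v a) (hbw : G.Adj b w)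
    (hwc : G.Adj w c) (hdv : G.Adj d v) (hxv : G.Adj x v) (hxw : G.Adj x w) : False := by
  have no : ∀ {e f s}, Traverse G e f s → s = x ::ₘ v ::ₘ w ::ₘ (P + Q) → ¬G.Adj f e :=
    fun h hs ↦ hno _ _ (hs ▸ h)
  obtain ⟨haP, hbP, hcQ, hdQ⟩ := 
    (⟨hP.left_mem, hP.right_mem, hQ.left_mem, hQ.right_mem⟩ : a ∈ P ∧ b ∈ P ∧ c ∈ Q ∧ d ∈ Q)
  have hwx : Traverse G w x (w ::ₘ {x}) := (single x).cons hxw.symm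
  have hxP : x ∉ P ∧ x ∉ Q := by simp_all
  have hvP : v ∉ P ∧ v ∉ Q := by simp_all
  have hwP : w ∉ P ∧ w ∉ Q := by simp_all
  have hPnd : P.Nodup := by simp_all [Multiset.nodup_add]
  have hPQ : ∀ z, z ∈ P → z ∉ Q := by
    simp only [Multiset.nodup_cons, Multiset.nodup_add] at hnd
    exact fun z h h' ↦ Multiset.disjoint_left.mp hnd.2.2.2.2.2 h h'
  have hvw : v ≠ w := by rintro rfl; simp at hnd
  have had : a ≠ d := fun h ↦ hPQ a haP (h ▸ hdQ)
  have hbc : b ≠ c := fun h ↦ hPQ b hbP (h ▸ hcQ)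
  obtain ⟨nxa, nxd, had'⟩ := not_adj_of_maximal hclaw
    (fun _ _ h ↦ no h (by simp only [← Multiset.singleton_add]; abel))
    ((hP.join hbw (hQ.cons hwc))) hva hdv had hxv (by simp [hxP, hxw.ne])
  obtain ⟨nxc, nxb, hcb'⟩ := not_adj_of_maximal hclaw
    (fun _ _ h ↦ no h (by simp only [← Multiset.singleton_add]; abel))
    ((hQ.join hdv (hP.cons hva))) hwc hbw hbc.symm hxw (by simp [hxP, hxv.ne])
  have ndw : ¬G.Adj d w := fun h ↦
    no (((hP.cons hva).join hcb'.symm hQ).join h hwx)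
      (by simp only [← Multiset.singleton_add]; abel) hxv
  have naw : ¬G.Adj a w := fun h ↦
    no (((hQ.symm.cons hdv.symm).join hcb' hP.symm).join h hwx)
      (by simp only [← Multiset.singleton_add]; abel) hxv
  have nbv : ¬G.Adj b v := fun h ↦
    no (((hQ.cons hwc).join had'.symm hP).join h ((single x).cons hxv.symm))
      (by simp only [← Multiset.singleton_add]; abel) hxw
  have ncv : ¬G.Adj c v := fun h ↦
    no (((hP.symm.cons hbw.symm).join had' hQ.symm).join h ((single x).cons hxv.symm))
      (by simp only [← Multiset.singleton_add]; abel) hxw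
  have nac : ¬G.Adj a c := fun h ↦
    no (((hQ.symm.cons hdv.symm).join h.symm hP).join hbw hwx)
      (by simp only [← Multiset.singleton_add]; abel) hxv
  have nbd : ¬G.Adj b d := fun h ↦
    no (((hP.cons hva).join h hQ.symm).join hwc.symm hwx)
      (by simp only [← Multiset.singleton_add]; abel) hxv
  have hvw' : G.Adj v w := by
    by_contra h
    have := hZ2 v a d x w
    grind [IsInducedZ2, G.adj_comm]
  have hcd : G.Adj c d := by
    by_contra h
    have := hZ2 v a d w c
    grind [IsInducedZ2, G.adj_comm]
  have hab : G.Adj a b := by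
    by_contra h
    have := hZ2 v a d w b
    grind [IsInducedZ2, G.adj_comm]
  obtain ⟨-, rfl⟩ | ⟨p, R, rfl, hap, hR⟩ := hP.eq_singleton_or_cons
  · exact G.loopless.irrefl _ hab
  have hpR := hR.left_mem
  have nxp : ¬G.Adj x p := fun hxp ↦ by
    obtain ⟨-, rfl⟩ | ⟨q, S, rfl, hpq, hS⟩ := hR.eq_singleton_or_cons
    · exact nxb hxp
    have hqS := hS.left_mem
    have haq : a ≠ q := by rintro rfl; simp_all
    obtain ⟨-, -, haq'⟩ := not_adj_of_maximal hclaw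
      (fun _ _ h ↦ no h (by simp only [← Multiset.singleton_add]; abel))
      ((hS.join hbw (hQ.cons hwc)).join hdv ((single a).cons hva)) hpq hap haq.symm hxp
      (by simp_all [hxv.ne, hxw.ne])
    exact no ((((hQ.symm.cons hdv.symm).join hwc.symm (hS.symm.cons hbw.symm)).join haq'
      ((single p).cons hap)).join hxp.symm (single x))
      (by simp only [← Multiset.singleton_add]; abel) hxv
  have hpQ : p ∉ Q := hPQ p (by simp [hpR])
  have npw : ¬G.Adj p w := fun h ↦ by
    have hpc : G.Adj p c := by
      by_contra h'
      have := hclaw w x p c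
      grind [IsInducedClaw, G.adj_comm]
    exact no (((((single a).cons hva).join had' hQ.symm).join hpc.symm hR).join hbw hwx)
      (by simp only [← Multiset.singleton_add]; abel) hxv
  have npv : ¬G.Adj p v := fun h ↦ by
    have hpd : G.Adj p d := by
      by_contra h'
      have := hclaw v x p d
      grind [IsInducedClaw, G.adj_comm]
    exact no (((((single a).cons hva).join hab hR.symm).join hpd hQ.symm).join hwc.symm hwx)
      (by simp only [← Multiset.singleton_add]; abel) hxv
  have := hZ2 v w x a p
  grind [IsInducedZ2, G.adj_comm]

end Traverse

namespace TwoConnected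

variable {V : Type*} {G : SimpleGraph V} [Fintype V]

theorem exists_adj_ne (h : TwoConnected G) {v u : V} (hvu : v ≠ u) :
    ∃ x, G.Adj v x ∧ x ≠ u := by
  classical
  obtain ⟨w, hw⟩ : ∃ w, w ∉ ({v, u} : Finset V) := by
    by_contra! hall
    have := Finset.card_le_card (Finset.subset_iff.mpr fun z (_ : z ∈ Finset.univ) ↦ hall z)
    have := h.1
    have := Finset.card_le_two (a := v) (b := u)
    simp only [Finset.card_univ] at *
    omega
  simp only [Finset.mem_insert, Finset.mem_singleton, not_or] at hw
  obtain ⟨y, z, hyz, -, hzu, rfl, -⟩ :=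
    (h.2 u).exists_adj_of_induce_ne (P := (· = v)) hvu hw.2 rfl hw.1
  exact ⟨z, hyz, hzu⟩

theorem exists_cyclic_traverse (h : TwoConnected G) :
    ∃ a b s, Traverse G a b s ∧ G.Adj b a ∧ s.Nodup ∧ 3 ≤ s.card := by
  have : Nontrivial V := Fintype.one_lt_card_iff_nontrivial.mp (by have := h.1; omega)
  obtain ⟨v, t, hvt⟩ := exists_pair_ne V
  obtain ⟨u, hvu, -⟩ := h.exists_adj_ne hvt
  obtain ⟨x, hvx, hxu⟩ := h.exists_adj_ne hvu.ne
  have key : ∃ s, Traverse G x u s ∧ s.Nodup ∧ v ∉ s := by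
    by_contra hu
    obtain ⟨y, z, hyz, -, hzv, ⟨s, hs, hnd, hvs⟩, hz⟩ :=
      (h.2 v).exists_adj_of_induce_ne (P := fun y ↦ ∃ s, Traverse G x y s ∧ s.Nodup ∧ v ∉ s)
        hvx.ne' hvu.ne' ⟨{x}, .single x, by simp, by simpa using hvx.ne⟩ hu
    by_cases hzs : z ∈ s
    · obtain ⟨s₁, hs₁, ⟨rfl, -⟩ | ⟨-, s₂, rfl, -⟩⟩ := hs.split hzs
      · exact hz ⟨_, hs₁, hnd, hvs⟩
      · exact hz ⟨s₁, hs₁, (Multiset.nodup_add.mp hnd).1, by simp_all⟩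
    · refine hz ⟨_, hs.join hyz (.single z), ?_, ?_⟩
      · rw [add_comm, Multiset.singleton_add]
        exact Multiset.nodup_cons.mpr ⟨hzs, hnd⟩
      · simp [hvs, hzv.symm]
  obtain ⟨s, hs, hnd, hvs⟩ := key
  refine ⟨v, u, _, hs.cons hvx, hvu.symm, Multiset.nodup_cons.mpr ⟨hvs, hnd⟩, ?_⟩
  obtain ⟨-, rfl⟩ | ⟨c, t, rfl, -, ht⟩ := hs.eq_singleton_or_cons
  · exact (hxu rfl).elim
  · have := Multiset.card_pos_iff_exists_mem.mpr ⟨c, ht.left_mem⟩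
    simp only [Multiset.card_cons]
    omega

end TwoConnected

theorem Traverse.isHamiltonian {V : Type*} {G : SimpleGraph V} [Fintype V] [DecidableEq V]
    {a b : V} {s : Multiset V}
    (h : Traverse G a b s) (hba : G.Adj b a) (hnd : s.Nodup) (hs : ∀ v, v ∈ s)
    (hcard : 3 ≤ s.card) : G.IsHamiltonian := by
  intro _
  obtain ⟨p, rfl⟩ := h.exists_walk
  have hp : p.IsPath := .mk' (Multiset.coe_nodup.mp hnd)
  refine ⟨b, .cons hba p, ?_⟩
  refine Walk.isHamiltonianCycle_iff_isCycle_and_support_count_tail_eq_one.mpr ⟨?_, ?_⟩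
  · refine (Walk.cons_isCycle_iff _ _).mpr ⟨hp, fun he ↦ ?_⟩
    have := hp.length_eq_one_of_mem_edges (Sym2.eq_swap ▸ he)
    simp [this] at hcard
  · exact hp.isHamiltonian_of_mem (by simpa using hs)

/-- **Gould–Jacobson theorem.** Every 2-connected `{K_{1,3}, Z₂}`-free graph
is Hamiltonian. -/
theorem gould_jacobson {V : Type*} [Fintype V] [DecidableEq V]
    (G : SimpleGraph V)
    (h2 : TwoConnected G)
    (hclaw : ∀ c a b d : V, ¬IsInducedClaw G c a b d)
    (hZ2 : ∀ a1 a2 a3 b1 c1 : V, ¬IsInducedZ2 G a1 a2 a3 b1 c1) :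
    G.IsHamiltonian := by
  classical
  obtain ⟨a₀, b₀, s₀, h₀, hba₀, hnd₀, hcard₀⟩ := h2.exists_cyclic_traverse
  obtain ⟨C, hC, hmax⟩ := Finset.exists_max_image
    ({C | ∃ a b, Traverse G a b C.val ∧ G.Adj b a} : Finset (Finset V)) Finset.card
    ⟨⟨s₀, hnd₀⟩, by simpa using ⟨a₀, b₀, h₀, hba₀⟩⟩
  simp only [Finset.mem_filter, Finset.mem_univ, true_and] at hC hmax
  obtain ⟨a, b, hab, hba⟩ := hC
  have hcard : 3 ≤ C.val.card := hcard₀.trans (hmax ⟨s₀, hnd₀⟩ ⟨a₀, b₀, h₀, hba₀⟩)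
  have hno {e f : V} {s : Multiset V} (hs : Traverse G e f s) (hnd : s.Nodup)
      (hlt : C.val.card < s.card) : ¬G.Adj f e := fun hfe ↦
    (hmax ⟨s, hnd⟩ ⟨e, f, hs, hfe⟩).not_gt hlt
  by_contra hham
  obtain ⟨z, hz⟩ : ∃ z, z ∉ C := by
    by_contra! hall
    exact hham (hab.isHamiltonian hba C.nodup hall hcard)
  have exists_neighbors {x v : V} (hxC : x ∉ C) (hvC : v ∈ C) (hxv : G.Adj x v) :
      ∃ c d t, C.val = v ::ₘ t ∧ c ≠ d ∧ G.Adj v c ∧ G.Adj d v ∧ Traverse G c d t ∧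
        ¬G.Adj x c ∧ ¬G.Adj x d ∧ G.Adj c d := by
    obtain ⟨c, d, t, hCt, hvc, hdv, ht⟩ := hab.exists_erase hba hvC
    have hnd := C.nodup
    have hcd : c ≠ d := by
      rintro rfl
      obtain ⟨rfl, -⟩ | ⟨e, r, rfl, -, hr⟩ := ht.eq_singleton_or_cons
      · simp [hCt] at hcard
      · have := hr.right_mem
        simp_all
    rw [← Finset.mem_val, hCt] at hxC
    rw [hCt] at hnd hno
    exact ⟨c, d, t, hCt, hcd, hvc, hdv, ht, Traverse.not_adj_of_maximal hclaw
      (fun e f h ↦ hno h (Multiset.nodup_cons.mpr ⟨hxC, hnd⟩) (by simp)) ht hvc hdv hcd hxv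
      (fun h ↦ hxC (Multiset.mem_cons_of_mem h))⟩
  have propagate {x v y : V} (hxC : x ∉ C) (hvC : v ∈ C) (hxv : G.Adj x v) (hyC : y ∉ C)
      (hxy : G.Adj x y) : G.Adj y v := by
    obtain ⟨c, d, t, hCt, hcd, hvc, hdv, ht, hxc, hxd, hcd'⟩ := exists_neighbors hxC hvC hxv
    have hnd : (x ::ₘ y ::ₘ C.val).Nodup := by
      simp [hxC, hyC, hxy.ne, C.nodup]
    have hyc : ¬G.Adj y c := by
      refine hno (s := x ::ₘ y ::ₘ C.val) ?_ hnd (by simp)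
      rw [hCt]
      convert ht.join hdv (((Traverse.single y).cons hxy).cons hxv.symm) using 1
      simp only [← Multiset.singleton_add]; abel
    have hyd : ¬G.Adj y d := by
      refine hno (s := x ::ₘ y ::ₘ C.val) ?_ hnd (by simp)
      rw [hCt]
      convert ht.symm.join hvc.symm (((Traverse.single y).cons hxy).cons hxv.symm) using 1
      simp only [← Multiset.singleton_add]; abel
    have hcC : c ∈ C := by simp [← Finset.mem_val, hCt, ht.left_mem]
    have hdC : d ∈ C := by simp [← Finset.mem_val, hCt, ht.right_mem]
    by_contra hyv
    have := hZ2 v c d x y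
    grind [IsInducedZ2, G.adj_comm]
  have exists_other (v : V) : ∃ u ∈ C, u ≠ v :=
    C.exists_mem_ne (by simpa using (by omega : 1 < C.val.card)) v
  obtain ⟨u, huC, -⟩ := exists_other z
  obtain ⟨u', huC', huu'⟩ := exists_other u
  obtain ⟨x, v, hxv, -, -, hxC, hvC⟩ := (h2.2 u).exists_adj_of_induce_ne (P := (· ∉ C))
    (by rintro rfl; exact hz huC) huu' hz (not_not.mpr huC')
  rw [not_not] at hvC
  obtain ⟨u'', huC'', huv⟩ := exists_other v
  obtain ⟨y, w, hyw, -, hwv, ⟨hyC, hyv⟩, hw⟩ := (h2.2 v).exists_adj_of_induce_ne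
    (P := fun y ↦ y ∉ C ∧ G.Adj y v) hxv.ne huv ⟨hxC, hxv⟩ (fun h ↦ h.1 huC'')
  have hwC : w ∈ C := by
    by_contra hwC
    exact hw ⟨hwC, propagate hyC hvC hyv hwC hyw⟩
  obtain ⟨c, d, t, hCt, hcd, hvc, hdv, ht, hyc, hyd, -⟩ := exists_neighbors hyC hvC hyv
  have hwt : w ∈ t := by
    rw [← Finset.mem_val, hCt] at hwC
    exact (Multiset.mem_cons.mp hwC).resolve_left hwv
  obtain ⟨s₁, hs₁, ⟨-, rfl⟩ | ⟨e, Q, rfl, hwe, hQ⟩⟩ := ht.split hwt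
  · exact hyd hyw
  obtain ⟨-, rfl⟩ | ⟨f, P, rfl, hwf, hP⟩ := hs₁.symm.eq_singleton_or_cons
  · exact hyc hyw
  rw [Multiset.cons_add] at hCt
  have hnd : (y ::ₘ v ::ₘ w ::ₘ (P + Q)).Nodup :=
    hCt ▸ Multiset.nodup_cons.mpr ⟨hyC, C.nodup⟩
  exact Traverse.false_of_two_neighbors hclaw hZ2
    (fun _ _ h ↦ hno h hnd (by rw [hCt]; simp)) hnd hP.symm hQ hvc hwf.symm hwe hdv hyv hyw
end

section
/- Let G be a 2-connected o-heavy graph on n vertices. If for every induced copy H of Z_1 in G and every pair of vertices u, v with distance 2 within H, either max{deg_G(u), deg_G(v)} ≥ n/2 or |N_G(u) ∩ N_G(v)| ≥ 2, then G is Hamiltonian. -/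
open SimpleGraph

/-- A vertex is heavy if its degree is at least `n/2`. -/
def Heavy {V : Type*} [Fintype V] (G : SimpleGraph V) [DecidableRel G.Adj] (v : V) : Prop :=
  Fintype.card V ≤ 2 * G.degree v

/-- `G` is 1-heavy: every induced claw has at least one heavy end-vertex. -/
def OneHeavy {V : Type*} [Fintype V] (G : SimpleGraph V) [DecidableRel G.Adj] : Prop :=
  ∀ c a b d : V, IsInducedClaw G c a b d → Heavy G a ∨ Heavy G b ∨ Heavy G d

/-- `G` is 2-heavy: every induced claw has at least two heavy end-vertices. -/
def TwoHeavy {V : Type*} [Fintype V] (G : SimpleGraph V) [DecidableRel G.Adj] : Prop :=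
  ∀ c a b d : V, IsInducedClaw G c a b d →
    (Heavy G a ∧ Heavy G b) ∨ (Heavy G a ∧ Heavy G d) ∨ (Heavy G b ∧ Heavy G d)

/-- `G` is o-heavy: every induced claw has two end-vertices with degree sum
at least `n`. -/
def OHeavy {V : Type*} [Fintype V] (G : SimpleGraph V) [DecidableRel G.Adj] : Prop :=
  ∀ c a b d : V, IsInducedClaw G c a b d →
    Fintype.card V ≤ G.degree a + G.degree b ∨
    Fintype.card V ≤ G.degree a + G.degree d ∨
    Fintype.card V ≤ G.degree b + G.degree d

/-- The pair `u, v` satisfies Fan's condition (`max{d(u),d(v)} ≥ n/2`) or Shi's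
condition (`|N(u) ∩ N(v)| ≥ 2`). -/
def FanOrShi {V : Type*} [Fintype V] [DecidableEq V]
    (G : SimpleGraph V) [DecidableRel G.Adj] (u v : V) : Prop :=
  Fintype.card V ≤ 2 * G.degree u ∨ Fintype.card V ≤ 2 * G.degree v ∨
  2 ≤ (G.neighborFinset u ∩ G.neighborFinset v).card

/-- `PathOn H a b S`: there is a path of `H` from `a` to `b` whose vertex set is `S`. -/
inductive PathOn {V : Type*} [DecidableEq V] (H : SimpleGraph V) : V → V → Finset V → Prop
  | single (a : V) : PathOn H a a {a}
  | cons {a b c : V} {S : Finset V} (hab : H.Adj a b) (hp : PathOn H b c S) (ha : a ∉ S) :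
      PathOn H a c (insert a S)

/-- `CycleOn H S`: there is a cycle of `H` whose vertex set is `S`. -/
def CycleOn {V : Type*} [DecidableEq V] (H : SimpleGraph V) (S : Finset V) : Prop :=
  3 ≤ S.card ∧ ∃ a b, PathOn H a b S ∧ H.Adj b a

namespace PathOn

variable {V : Type*} [DecidableEq V] {H K : SimpleGraph V} {a b c d x : V} {S T : Finset V}

theorem left_mem (h : PathOn H a b S) : a ∈ S := by
  cases h <;> simp

theorem right_mem (h : PathOn H a b S) : b ∈ S := by
  induction h with
  | single => simp
  | cons _ _ _ ih => exact Finset.mem_insert_of_mem ih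

theorem mono (hHK : H ≤ K) (h : PathOn H a b S) : PathOn K a b S := by
  induction h with
  | single a => exact single a
  | cons hab _ ha ih => exact cons (hHK hab) ih ha

theorem append (h : PathOn H a b S) (h' : PathOn H c d T) (hbc : H.Adj b c)
    (hST : Disjoint S T) : PathOn H a d (S ∪ T) := by
  induction h with
  | single a =>
    rw [← Finset.insert_eq]
    exact cons hbc h' (by simpa using hST)
  | cons hab _ ha ih =>
    rw [Finset.disjoint_insert_left] at hST
    rw [Finset.insert_union]
    exact cons hab (ih hbc hST.2) (by simp [ha, hST.1])

theorem reverse (h : PathOn H a b S) : PathOn H b a S := by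
  induction h with
  | single a => exact single a
  | @cons a b c S hab _ ha ih =>
    have := ih.append (single a) hab.symm (by simpa using ha)
    rwa [Finset.union_comm, ← Finset.insert_eq] at this

theorem eq_singleton (h : PathOn H a a S) : S = {a} := by
  cases h with
  | single => rfl
  | cons _ hp ha => exact absurd hp.right_mem ha

theorem eq_or_exists_tail (h : PathOn H a b S) :
    (a = b ∧ S = {a}) ∨ ∃ c, H.Adj a c ∧ PathOn H c b (S.erase a) := by
  cases h with
  | single => simp
  | cons hab hp ha =>
    right
    exact ⟨_, hab, by rwa [Finset.erase_insert ha]⟩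

theorem split (h : PathOn H a b S) (hx : x ∈ S) :
    ∃ A B, Disjoint A B ∧ S = A ∪ B ∧ PathOn H x b B ∧
      ((x = a ∧ A = ∅) ∨ ∃ y, PathOn H a y A ∧ H.Adj y x) := by
  induction h with
  | single a =>
    obtain rfl : x = a := by simpa using hx
    exact ⟨∅, {x}, by simp, by simp, single x, Or.inl ⟨rfl, rfl⟩⟩
  | @cons a b c S hab hp ha ih =>
    by_cases hxa : x = a
    · subst hxa
      exact ⟨∅, insert x S, by simp, by simp, cons hab hp ha, Or.inl ⟨rfl, rfl⟩⟩
    · obtain ⟨A, B, hAB, rfl, hB, hA⟩ := ih (Finset.mem_of_mem_insert_of_ne hx hxa)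
      have haA : a ∉ A := fun h => ha (Finset.mem_union_left _ h)
      have haB : a ∉ B := fun h => ha (Finset.mem_union_right _ h)
      refine ⟨insert a A, B, by simp [haB, hAB], by simp, hB, Or.inr ?_⟩
      obtain ⟨rfl, rfl⟩ | ⟨y, hy, hyx⟩ := hA
      · exact ⟨a, by simpa using single a, hab⟩
      · exact ⟨y, cons hab hy haA, hyx⟩

theorem exists_first_mem (h : PathOn H a b T) (ha : a ∉ S) (hb : b ∈ S) :
    ∃ y x Z, PathOn H a y Z ∧ Disjoint Z S ∧ Z ⊆ T ∧ x ∈ T ∧ x ∈ S ∧ H.Adj y x := by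
  induction h with
  | single => exact absurd hb ha
  | @cons a b c T hab hp haT ih =>
    by_cases hbS : b ∈ S
    · exact ⟨a, b, {a}, single a, by simpa using ha, by simp, by simp [hp.left_mem], hbS, hab⟩
    · obtain ⟨y, x, Z, hZ, hd, hZT, hxT, hxS, hyx⟩ := ih hbS hb
      exact ⟨y, x, insert a Z, cons hab hZ fun h => haT (hZT h), by simp [ha, hd],
        Finset.insert_subset_insert _ hZT, by simp [hxT], hxS, hyx⟩

theorem exists_of_isClique (hS : S.Nonempty) (h : H.IsClique S) : ∃ a b, PathOn H a b S := by
  induction hS using Finset.Nonempty.cons_induction with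
  | singleton a => exact ⟨a, a, single a⟩
  | cons a S ha hS ih =>
    obtain ⟨b, c, hbc⟩ := ih (h.subset (by simp))
    rw [Finset.cons_eq_insert] at h ⊢
    have hne : a ≠ b := fun hab => ha (hab ▸ hbc.left_mem)
    exact ⟨a, c, cons (h (by simp) (by simp [hbc.left_mem]) hne) hbc ha⟩

theorem exists_of_walk (p : H.Walk a b) : ∃ S, PathOn H a b S ∧ ∀ y ∈ S, y ∈ p.support := by
  induction p with
  | @nil a => exact ⟨{a}, single a, by simp⟩
  | @cons a b c hab p ih =>
    obtain ⟨S, hS, hsub⟩ := ih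
    by_cases ha : a ∈ S
    · obtain ⟨A, B, -, rfl, hB, -⟩ := hS.split ha
      exact ⟨B, hB, fun y hy => by simp [hsub y (Finset.mem_union_right _ hy)]⟩
    · refine ⟨insert a S, cons hab hS ha, fun y hy => ?_⟩
      obtain rfl | hy := Finset.mem_insert.mp hy
      · simp
      · simp [hsub y hy]

theorem exists_walk (h : PathOn H a b S) :
    ∃ p : H.Walk a b, p.IsPath ∧ ∀ y, y ∈ p.support ↔ y ∈ S := by
  induction h with
  | single a => exact ⟨.nil, by simp, by simp⟩
  | @cons a b c S hab hp ha ih =>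
    obtain ⟨p, hpath, hsupp⟩ := ih
    exact ⟨.cons hab p, by simp [hpath, hsupp, ha], by simp [hsupp]⟩

/-- Deleting an edge from the graph leaves a path intact or breaks it into two paths. -/
theorem deleteEdge (h : PathOn H a b S) (u v : V) :
    PathOn (H.deleteEdges {s(u, v)}) a b S ∨
    ∃ c d A B, PathOn (H.deleteEdges {s(u, v)}) a c A ∧ PathOn (H.deleteEdges {s(u, v)}) d b B ∧
      Disjoint A B ∧ S = A ∪ B ∧ s(c, d) = s(u, v) := by
  induction h with
  | single a => exact Or.inl (single a)
  | @cons a b c S hab hp ha ih =>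
    obtain ih | ⟨c', d', A, B, hA, hB, hAB, rfl, he⟩ := ih
    · by_cases he : s(a, b) = s(u, v)
      · exact Or.inr ⟨a, b, {a}, S, single a, ih, by simpa using ha, rfl, he⟩
      · exact Or.inl (cons (by simp [hab, he]) ih ha)
    · rw [Finset.mem_union, not_or] at ha
      have hne : s(a, b) ≠ s(u, v) := by
        rw [← he]
        intro h
        have : a ∈ s(c', d') := h ▸ Sym2.mem_mk_left a b
        obtain rfl | rfl := Sym2.mem_iff.mp this
        · exact ha.1 hA.right_mem
        · exact ha.2 hB.left_mem
      exact Or.inr ⟨c', d', insert a A, B, cons (by simpa [hab] using hne) hA ha.1, hB,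
        by simp [hAB, ha.2], by simp, he⟩

/-- Pósa's crossing argument: a path either contains consecutive vertices `x`, `y` with `P x` and
`Q y`, or few of its vertices satisfy `P` or `Q`. -/
theorem crossing (h : PathOn H a b S) (P Q : V → Prop) [DecidablePred P] [DecidablePred Q] :
    (∃ x y A B, PathOn H a x A ∧ PathOn H y b B ∧ Disjoint A B ∧ S = A ∪ B ∧ P x ∧ Q y) ∨
    (S.filter P).card + (S.filter Q).card + 1 ≤
      S.card + (if Q a then 1 else 0) + (if P b then 1 else 0) := by
  induction h with
  | single a =>
    right
    simp only [Finset.filter_singleton, Finset.card_singleton]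
    split_ifs <;> simp
  | @cons a b c S hab hp ha ih =>
    obtain ⟨x, y, A, B, hA, hB, hAB, rfl, hx, hy⟩ | ih := ih
    · rw [Finset.mem_union, not_or] at ha
      exact Or.inl ⟨x, y, insert a A, B, cons hab hA ha.1, hB, by simp [hAB, ha.2], by simp, hx, hy⟩
    · by_cases hPQ : P a ∧ Q b
      · exact Or.inl ⟨a, b, {a}, S, single a, hp, by simpa using ha, rfl, hPQ.1, hPQ.2⟩
      · right
        have h1 : ∀ R : V → Prop, [DecidablePred R] → ((insert a S).filter R).card =
            (S.filter R).card + if R a then 1 else 0 := by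
          intro R _
          rw [Finset.filter_insert]
          split_ifs <;> simp [ha]
        rw [h1, h1, Finset.card_insert_of_notMem ha]
        split_ifs at ih ⊢ <;> first | omega | tauto

end PathOn

namespace CycleOn

variable {V : Type*} [DecidableEq V] {H K : SimpleGraph V} {a b x : V} {S T : Finset V}

theorem mono (hHK : H ≤ K) : CycleOn H S → CycleOn K S := by
  rintro ⟨h3, a, b, hp, hba⟩
  exact ⟨h3, a, b, hp.mono hHK, hHK hba⟩

theorem of_path (h : PathOn H a b T) (hxT : x ∉ T) (hab : a ≠ b) (hxa : H.Adj x a)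
    (hbx : H.Adj b x) : CycleOn H (insert x T) := by
  refine ⟨?_, x, b, .cons hxa h hxT, hbx⟩
  rw [Finset.card_insert_of_notMem hxT]
  have : 1 < T.card := Finset.one_lt_card.mpr ⟨a, h.left_mem, b, h.right_mem, hab⟩
  omega

theorem exists_path_erase (h : CycleOn H S) (hx : x ∈ S) :
    ∃ a b, PathOn H a b (S.erase x) ∧ H.Adj x a ∧ H.Adj b x ∧ a ≠ b := by
  obtain ⟨h3, a, b, hp, hba⟩ := h
  obtain ⟨y, hy, hyx⟩ : ∃ y, PathOn H x y S ∧ H.Adj y x := by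
    obtain ⟨A, B, hAB, rfl, hB, ⟨rfl, rfl⟩ | ⟨y, hy, hyx⟩⟩ := hp.split hx
    · exact ⟨b, by simpa using hB, hba⟩
    · exact ⟨y, Finset.union_comm A B ▸ hB.append hy hba hAB.symm, hyx⟩
  obtain ⟨-, rfl⟩ | ⟨c, hxc, hc⟩ := hy.eq_or_exists_tail
  · simp at h3
  · refine ⟨c, y, hc, hxc, hyx, ?_⟩
    rintro rfl
    have := congrArg Finset.card hc.eq_singleton
    rw [Finset.card_erase_of_mem hx, Finset.card_singleton] at this
    omega

theorem isHamiltonian [Fintype V] (h : CycleOn H Finset.univ) : H.IsHamiltonian := by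
  intro _
  obtain ⟨x, -⟩ : (Finset.univ : Finset V).Nonempty := Finset.card_pos.mp (by have := h.1; omega)
  obtain ⟨a, b, hab, hxa, hbx, hne⟩ := h.exists_path_erase (Finset.mem_univ x)
  obtain ⟨p, hp, hsupp⟩ := hab.exists_walk
  have hx : x ∉ p.support := by simp [hsupp]
  have hcyc : (Walk.cons hxa (p.concat hbx)).IsCycle := by
    rw [Walk.cons_isCycle_iff]
    refine ⟨hp.concat hx hbx, ?_⟩
    rw [Walk.edges_concat, List.concat_eq_append, List.mem_append, not_or]
    refine ⟨fun h => hx (p.fst_mem_support_of_mem_edges h), ?_⟩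
    rw [List.mem_singleton, Sym2.eq_swap, Sym2.eq_iff]
    rintro (⟨h, -⟩ | ⟨h, -⟩)
    · exact hne h
    · exact hxa.ne h.symm
  refine ⟨x, _, (Walk.isHamiltonianCycle_iff_isCycle_and_support_count_tail_eq_one).mpr
    ⟨hcyc, fun y => ?_⟩⟩
  apply List.count_eq_one_of_mem hcyc.support_nodup
  by_cases hy : y = x <;> simp [Walk.support_concat, hsupp, hy]

end CycleOn

theorem TwoConnected.exists_path {V : Type*} [Fintype V] [DecidableEq V] {G : SimpleGraph V}
    {a b x : V} (h2 : TwoConnected G) (ha : a ≠ x) (hb : b ≠ x) :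
    ∃ S, PathOn G a b S ∧ x ∉ S := by
  obtain ⟨p⟩ := (h2.2 x).preconnected ⟨a, ha⟩ ⟨b, hb⟩
  obtain ⟨S, hS, hsub⟩ := PathOn.exists_of_walk (p.map (Embedding.induce _).toHom)
  refine ⟨S, hS, fun hx => ?_⟩
  have := hsub x hx
  rw [Walk.support_map, List.mem_map] at this
  obtain ⟨y, -, hy⟩ := this
  exact y.2 hy

theorem TwoConnected.exists_adj_ne_s6 {V : Type*} [Fintype V] [DecidableEq V] {G : SimpleGraph V}
    {u v : V} (h2 : TwoConnected G) (hv : u ≠ v) :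
    ∃ w, G.Adj u w ∧ w ≠ v := by
  obtain ⟨t, ht⟩ : ∃ t, t ∉ ({u, v} : Finset V) := by
    by_contra! hcon
    have h1 := Finset.card_le_card (fun t _ => hcon t : Finset.univ ⊆ ({u, v} : Finset V))
    have := (Finset.card_le_two (a := u) (b := v))
    have := h2.1
    rw [Finset.card_univ] at h1
    omega
  simp only [Finset.mem_insert, Finset.mem_singleton, not_or] at ht
  obtain ⟨S, hS, hvS⟩ := h2.exists_path hv ht.2
  obtain ⟨h, -⟩ | ⟨w, huw, hw⟩ := hS.eq_or_exists_tail
  · exact absurd h.symm ht.1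
  · exact ⟨w, huw, fun h => hvS (h ▸ Finset.mem_of_mem_erase hw.left_mem)⟩

section OreClosure

variable {V : Type*} [Fintype V] [DecidableEq V] {G K : SimpleGraph V} [DecidableRel G.Adj]
  {a b u v x y : V} {S T : Finset V}

/-- The graph obtained from `G` by joining all pairs of vertices with degree sum at least `n`.
Its cycles are the o-cycles of `G`. -/
def oClosure {V : Type*} [Fintype V] [DecidableEq V] (G : SimpleGraph V) [DecidableRel G.Adj] :
    SimpleGraph V where
  Adj u v := u ≠ v ∧ (G.Adj u v ∨ Fintype.card V ≤ G.degree u + G.degree v)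
  symm := ⟨fun u v h => ⟨h.1.symm, h.2.imp (fun h => h.symm) (by rw [add_comm]; exact id)⟩⟩
  loopless := ⟨fun _ h => h.1 rfl⟩

theorem le_oClosure (G : SimpleGraph V) [DecidableRel G.Adj] : G ≤ oClosure G :=
  fun _ _ h => ⟨h.ne, Or.inl h⟩

theorem PathOn.exists_cycleOn (h : PathOn K u v S) (hGK : G ≤ K) (h3 : 3 ≤ S.card)
    (hdeg : Fintype.card V ≤ G.degree u + G.degree v) : ∃ T, S ⊆ T ∧ CycleOn K T := by
  by_cases hw : ∃ w ∉ S, G.Adj u w ∧ G.Adj v w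
  · obtain ⟨w, hwS, huw, hvw⟩ := hw
    have huv : u ≠ v := by
      rintro rfl
      simp [h.eq_singleton] at h3
    exact ⟨insert w S, by simp, .of_path h hwS huv (hGK huw.symm) (hGK hvw)⟩
  obtain ⟨x, y, A, B, hA, hB, hAB, rfl, hx, hy⟩ | hle := h.crossing (G.Adj v) (G.Adj u)
  · exact ⟨A ∪ B, subset_rfl, h3, x, v, hA.reverse.append hB (hGK hy) hAB, hGK hx⟩
  · exfalso
    have hd : ∀ z, G.degree z = (S.filter (G.Adj z)).card + (Sᶜ.filter (G.Adj z)).card := by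
      intro z
      rw [← card_neighborFinset_eq_degree, neighborFinset_eq_filter,
        ← Finset.card_union_of_disjoint
          (Finset.disjoint_filter_filter disjoint_compl_right), ← Finset.filter_union,
        Finset.union_compl]
    have hout : (Sᶜ.filter (G.Adj u)).card + (Sᶜ.filter (G.Adj v)).card ≤ Sᶜ.card := by
      rw [← Finset.card_union_of_disjoint]
      · exact Finset.card_le_card
          (Finset.union_subset (Finset.filter_subset _ _) (Finset.filter_subset _ _))
      · rw [Finset.disjoint_filter]
        exact fun w hwS huw hvw => hw ⟨w, Finset.mem_compl.mp hwS, huw, hvw⟩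
    have := Finset.card_add_card_compl S
    have := hd u
    have := hd v
    simp only [G.irrefl, if_false] at hle
    omega

theorem CycleOn.exists_deleteEdge (h : CycleOn K S) (hGK : G ≤ K.deleteEdges {s(u, v)})
    (hdeg : Fintype.card V ≤ G.degree u + G.degree v) :
    ∃ T, S ⊆ T ∧ CycleOn (K.deleteEdges {s(u, v)}) T := by
  obtain ⟨h3, a, b, hp, hba⟩ := h
  obtain hp | ⟨c, d, A, B, hA, hB, hAB, rfl, he⟩ := hp.deleteEdge u v
  · by_cases he : s(b, a) = s(u, v)
    · obtain ⟨rfl, rfl⟩ | ⟨rfl, rfl⟩ := Sym2.eq_iff.mp he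
      · exact hp.exists_cycleOn hGK h3 (by omega)
      · exact hp.exists_cycleOn hGK h3 hdeg
    · exact ⟨S, subset_rfl, h3, a, b, hp, by simp [hba, he]⟩
  · have hne : s(b, a) ≠ s(u, v) := by
      rw [← he]
      intro h
      obtain ⟨rfl, rfl⟩ | ⟨rfl, rfl⟩ := Sym2.eq_iff.mp h
      · exact Finset.disjoint_left.mp hAB hA.right_mem hB.right_mem
      · simp [hA.eq_singleton, hB.eq_singleton] at h3
        have := Finset.card_le_two (a := a) (b := b)
        simp_all
        omega
    have hdc := hB.append hA (by simp [hba, hne]) hAB.symm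
    rw [Finset.union_comm] at hdc
    obtain ⟨rfl, rfl⟩ | ⟨rfl, rfl⟩ := Sym2.eq_iff.mp he
    · exact hdc.exists_cycleOn hGK h3 (by omega)
    · exact hdc.exists_cycleOn hGK h3 hdeg

/-- The vertices of an o-cycle lie on a common cycle. -/
theorem CycleOn.exists_of_le_oClosure (h : CycleOn K S) (hGK : G ≤ K) (hK : K ≤ oClosure G) :
    ∃ T, S ⊆ T ∧ CycleOn G T := by
  induction K using (wellFounded_lt (α := SimpleGraph V)).induction generalizing S with
  | _ K ih =>
  by_cases hKG : K ≤ G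
  · exact ⟨S, subset_rfl, h.mono hKG⟩
  obtain ⟨u, v, huv, hG⟩ : ∃ u v, K.Adj u v ∧ ¬G.Adj u v := by
    by_contra! hcon
    exact hKG fun u v => hcon u v
  have hGK' : G ≤ K.deleteEdges {s(u, v)} := by
    intro x y hxy
    rw [deleteEdges_adj]
    refine ⟨hGK hxy, fun he => hG ?_⟩
    obtain ⟨rfl, rfl⟩ | ⟨rfl, rfl⟩ := Sym2.eq_iff.mp (Set.mem_singleton_iff.mp he)
    exacts [hxy, hxy.symm]
  have hlt : K.deleteEdges {s(u, v)} < K :=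
    lt_of_le_of_ne (deleteEdges_le _) fun he => by
      have := he ▸ huv
      simp at this
  obtain ⟨T, hST, hT⟩ := h.exists_deleteEdge hGK' ((hK huv).2.resolve_left hG)
  obtain ⟨T', hTT', hT'⟩ := ih _ hlt hT hGK' (hlt.le.trans hK)
  exact ⟨T', hST.trans hTT', hT'⟩

theorem TwoConnected.exists_cycleOn_of_adj (h2 : TwoConnected G) (huv : (oClosure G).Adj u v) :
    ∃ S, CycleOn (oClosure G) S ∧ u ∈ S ∧ v ∈ S := by
  obtain ⟨w, huw, hwv⟩ := h2.exists_adj_ne_s6 huv.ne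
  obtain ⟨S, hS, huS⟩ := h2.exists_path huw.ne.symm huv.ne.symm
  exact ⟨insert u S, .of_path (hS.mono (le_oClosure G)) huS hwv (le_oClosure G huw) huv.symm,
    by simp, by simp [hS.right_mem]⟩

theorem TwoConnected.exists_cycleOn_heavy (h2 : TwoConnected G) :
    ∃ S, CycleOn (oClosure G) S ∧ ∀ v, Heavy G v → v ∈ S := by
  classical
  have hadj : ∀ u v, Heavy G u → Heavy G v → u ≠ v → (oClosure G).Adj u v := by
    intro u v hu hv huv
    unfold Heavy at hu hv
    exact ⟨huv, Or.inr (by omega)⟩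
  by_cases h3 : 3 ≤ (Finset.univ.filter (Heavy G)).card
  · obtain ⟨a, b, hab⟩ := PathOn.exists_of_isClique (H := oClosure G)
      (S := Finset.univ.filter (Heavy G)) (Finset.card_pos.mp (by omega))
      (fun u hu v hv huv => hadj u v (by simpa using hu) (by simpa using hv) huv)
    refine ⟨_, ⟨h3, a, b, hab, hadj b a ?_ ?_ ?_⟩, by simp⟩
    · simpa using hab.right_mem
    · simpa using hab.left_mem
    · rintro rfl
      simp [hab.eq_singleton] at h3
  · obtain ⟨u, v, huv, hW⟩ : ∃ u v, (oClosure G).Adj u v ∧ ∀ w, Heavy G w → w = u ∨ w = v := by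
      by_cases hW : ∃ u v, Heavy G u ∧ Heavy G v ∧ u ≠ v
      · obtain ⟨u, v, hu, hv, huv⟩ := hW
        refine ⟨u, v, hadj u v hu hv huv, fun w hw => ?_⟩
        by_contra! hne
        have hsub : {w, u, v} ⊆ Finset.univ.filter (Heavy G) := by
          intro t
          simp only [Finset.mem_insert, Finset.mem_singleton, Finset.mem_filter_univ]
          rintro (rfl | rfl | rfl) <;> assumption
        have := Finset.card_le_card hsub
        rw [Finset.card_eq_three.mpr ⟨w, u, v, hne.1, hne.2, huv, rfl⟩] at this
        exact h3 this
      · push Not at hW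
        obtain ⟨u, hu⟩ : ∃ u, ∀ w, Heavy G w → w = u := by
          by_cases hex : ∃ u, Heavy G u
          · obtain ⟨u, hu⟩ := hex
            exact ⟨u, fun w hw => hW w u hw hu⟩
          · push Not at hex
            have : Nonempty V := Fintype.card_pos_iff.mp (by have := h2.1; omega)
            exact ⟨Classical.arbitrary V, fun w hw => absurd hw (hex w)⟩
        obtain ⟨t, ht⟩ := Fintype.exists_ne_of_one_lt_card (by have := h2.1; omega) u
        obtain ⟨v, huv, -⟩ := h2.exists_adj_ne_s6 ht.symm
        exact ⟨u, v, le_oClosure G huv, fun w hw => Or.inl (hu w hw)⟩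
    obtain ⟨S, hS, hu, hv⟩ := h2.exists_cycleOn_of_adj huv
    refine ⟨S, hS, fun w hw => ?_⟩
    obtain rfl | rfl := hW w hw <;> assumption

theorem TwoConnected.exists_maximal_cycleOn (h2 : TwoConnected G) :
    ∃ S, CycleOn G S ∧ (∀ v, Heavy G v → v ∈ S) ∧
      ∀ T, CycleOn (oClosure G) T → S ⊆ T → T ⊆ S := by
  obtain ⟨S, hS, hheavy⟩ := h2.exists_cycleOn_heavy
  obtain ⟨M, hSM, hM⟩ := (Set.toFinite {T | CycleOn (oClosure G) T}).exists_le_maximal hS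
  obtain ⟨T, hMT, hT⟩ := hM.prop.exists_of_le_oClosure (le_oClosure G) le_rfl
  have hTM := hM.eq_of_le (hT.mono (le_oClosure G)) hMT
  subst hTM
  exact ⟨M, hT, fun v hv => hSM (hheavy v hv), fun T hT hMT => hM.le_of_ge hT hMT⟩

end OreClosure

/-- A cycle on `S` passing through `x` and `y`, cut into an arc from `p` to `q` on `A` and an arc
from `r` to `m` on `B`, so that its cyclic order is `x, p, …, q, y, r, …, m`. -/
structure TwoArcs {V : Type*} [DecidableEq V] (H : SimpleGraph V) (S : Finset V)
    (x p q : V) (A : Finset V) (y r m : V) (B : Finset V) : Prop where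
  pathA : PathOn H p q A
  pathB : PathOn H r m B
  adj_xp : H.Adj x p
  adj_qy : H.Adj q y
  adj_yr : H.Adj y r
  adj_mx : H.Adj m x
  disjoint : Disjoint A B
  x_notMem_A : x ∉ A
  x_notMem_B : x ∉ B
  y_notMem_A : y ∉ A
  y_notMem_B : y ∉ B
  ne : x ≠ y
  eq_insert : S = insert x (insert y (A ∪ B))

namespace TwoArcs

variable {V : Type*} [DecidableEq V] {H K : SimpleGraph V} {S A B Z : Finset V}
  {x p q y r m z w : V}

theorem symm (h : TwoArcs H S x p q A y r m B) : TwoArcs H S y r m B x p q A :=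
  ⟨h.pathB, h.pathA, h.adj_yr, h.adj_mx, h.adj_xp, h.adj_qy, h.disjoint.symm, h.y_notMem_B,
    h.y_notMem_A, h.x_notMem_B, h.x_notMem_A, h.ne.symm, by
      rw [h.eq_insert, Finset.insert_comm, Finset.union_comm]⟩

theorem reverse (h : TwoArcs H S x p q A y r m B) : TwoArcs H S x m r B y q p A :=
  ⟨h.pathB.reverse, h.pathA.reverse, h.adj_mx.symm, h.adj_yr.symm, h.adj_qy.symm, h.adj_xp.symm,
    h.disjoint.symm, h.x_notMem_B, h.x_notMem_A, h.y_notMem_B, h.y_notMem_A, h.ne, by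
      rw [h.eq_insert, Finset.union_comm]⟩

theorem mono (hHK : H ≤ K) (h : TwoArcs H S x p q A y r m B) : TwoArcs K S x p q A y r m B :=
  ⟨h.pathA.mono hHK, h.pathB.mono hHK, hHK h.adj_xp, hHK h.adj_qy, hHK h.adj_yr, hHK h.adj_mx,
    h.disjoint, h.x_notMem_A, h.x_notMem_B, h.y_notMem_A, h.y_notMem_B, h.ne, h.eq_insert⟩

theorem path_erase (h : TwoArcs H S x p q A y r m B) : PathOn H p m (S.erase x) := by
  have hd : Disjoint A (insert y B) := by simp [h.y_notMem_A, h.disjoint]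
  have := h.pathA.append (.cons h.adj_yr h.pathB h.y_notMem_B) h.adj_qy hd
  rwa [h.eq_insert, Finset.erase_insert (by
    simp [h.ne, h.x_notMem_A, h.x_notMem_B]), ← Finset.union_insert]

theorem ends_ne (h : TwoArcs H S x p q A y r m B) : p ≠ m := by
  rintro rfl
  exact Finset.disjoint_left.mp h.disjoint h.pathA.left_mem h.pathB.right_mem

theorem starts_ne (h : TwoArcs H S x p q A y r m B) : p ≠ r := by
  rintro rfl
  exact Finset.disjoint_left.mp h.disjoint h.pathA.left_mem h.pathB.left_mem

theorem exists_of_path (hp : PathOn H p m (S.erase x)) (hx : x ∈ S) (hxp : H.Adj x p)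
    (hmx : H.Adj m x) (hy : y ∈ S) (hyx : y ≠ x) (hyp : y ≠ p) (hym : y ≠ m) :
    ∃ q A r B, TwoArcs H S x p q A y r m B := by
  obtain ⟨A, B, hAB, hS, hB, ⟨rfl, -⟩ | ⟨q, hA, hqy⟩⟩ :=
    hp.split (Finset.mem_erase.mpr ⟨hyx, hy⟩)
  · exact absurd rfl hyp
  obtain ⟨rfl, -⟩ | ⟨r, hyr, hr⟩ := hB.eq_or_exists_tail
  · exact absurd rfl hym
  have hx' : x ∉ A ∪ B := hS ▸ Finset.notMem_erase x S
  rw [Finset.mem_union, not_or] at hx'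
  refine ⟨q, A, r, B.erase y, hA, hr, hxp, hqy, hyr, hmx,
    hAB.mono_right (Finset.erase_subset _ _), hx'.1, fun h => hx'.2 (Finset.mem_of_mem_erase h),
    Finset.disjoint_right.mp hAB hB.left_mem, Finset.notMem_erase _ _, hyx.symm, ?_⟩
  rw [← Finset.union_insert, Finset.insert_erase hB.left_mem, ← hS, Finset.insert_erase hx]

theorem exists_cycleOn_of_starts_adj (h : TwoArcs H S x p q A y r m B) (hZ : PathOn H z w Z)
    (hd : Disjoint Z S) (hxz : H.Adj x z) (hwy : H.Adj w y) (hpr : H.Adj p r) :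
    ∃ T, S ⊆ T ∧ z ∈ T ∧ CycleOn H T := by
  have hS := h.eq_insert
  subst hS
  simp only [Finset.disjoint_insert_right] at hd
  obtain ⟨hxZ, hyZ, hd⟩ := hd
  have hpath := hZ.append (.cons h.adj_qy.symm (h.pathA.reverse.append h.pathB hpr h.disjoint)
    (by simp [h.y_notMem_A, h.y_notMem_B])) hwy (by simp [hyZ, hd])
  refine ⟨_, ?_, ?_, .of_path hpath ?_ ?_ hxz h.adj_mx⟩
  · exact Finset.insert_subset_insert _ Finset.subset_union_right
  · simp [hZ.left_mem]
  · simp [hxZ, h.ne, h.x_notMem_A, h.x_notMem_B]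
  · rintro rfl
    exact Finset.disjoint_left.mp hd hZ.left_mem (Finset.mem_union_right _ h.pathB.right_mem)

theorem exists_cycleOn_of_chord (h : TwoArcs H S x p q A y r m B) (hzS : z ∉ S)
    (hxz : H.Adj x z) (hzy : H.Adj z y) (hqr : H.Adj q r) (hpy : H.Adj p y) :
    ∃ T, S ⊆ T ∧ z ∈ T ∧ CycleOn H T := by
  have hS := h.eq_insert
  subst hS
  simp only [Finset.mem_insert, Finset.mem_union, not_or] at hzS
  obtain ⟨hzx, hzy', hzA, hzB⟩ := hzS
  have hpath := (h.pathA.append h.pathB hqr h.disjoint).append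
    (.cons hxz (.single z) (by simpa using Ne.symm hzx)) h.adj_mx
    (by simp [h.x_notMem_A, h.x_notMem_B, hzA, hzB])
  refine ⟨_, ?_, ?_, .of_path hpath ?_ ?_ hpy.symm hzy⟩
  · intro t
    simp only [Finset.mem_insert, Finset.mem_union]
    tauto
  · simp
  · simp [h.y_notMem_A, h.y_notMem_B, h.ne.symm, Ne.symm hzy']
  · rintro rfl
    exact hzA h.pathA.left_mem

end TwoArcs

section MaximalCycle

variable {V : Type*} [Fintype V] [DecidableEq V] {G : SimpleGraph V} [DecidableRel G.Adj]
  {S : Finset V} {x p m z y : V}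

/-- A cycle whose vertex set is maximal among the vertex sets of o-cycles. -/
def MaximalCycleOn (G : SimpleGraph V) [DecidableRel G.Adj] (S : Finset V) : Prop :=
  CycleOn G S ∧ ∀ T, CycleOn (oClosure G) T → S ⊆ T → T ⊆ S

theorem MaximalCycleOn.false_of_exists (hS : MaximalCycleOn G S) (hz : z ∉ S)
    (h : ∃ T, S ⊆ T ∧ z ∈ T ∧ CycleOn (oClosure G) T) : False := by
  obtain ⟨T, hST, hzT, hT⟩ := h
  exact hz (hS.2 T hT hST hzT)

theorem MaximalCycleOn.not_adj_of_succ (hS : MaximalCycleOn G S) (hz : z ∉ S)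
    (hp : PathOn G p m (S.erase x)) (hmx : G.Adj m x) (hxz : G.Adj x z) :
    ¬(oClosure G).Adj p z := by
  intro hpz
  have hle := le_oClosure G
  refine hS.false_of_exists hz ⟨_, ?_, ?_, .of_path
    (.cons hpz.symm (hp.mono hle) (by simp [hz])) ?_ ?_ (hle hxz) (hle hmx)⟩
  · intro t ht
    by_cases htx : t = x <;> simp [htx, ht]
  · simp
  · simp [hxz.ne]
  · rintro rfl
    exact hz (Finset.mem_of_mem_erase hp.right_mem)

theorem MaximalCycleOn.eq_of_common_adj (hS : MaximalCycleOn G S) (hz : z ∉ S) (hx : x ∈ S)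
    (hp : PathOn G p m (S.erase x)) (hxp : G.Adj x p) (hmx : G.Adj m x) (hxz : G.Adj x z)
    (hsucc : ∀ y q A r B, TwoArcs G S x p q A y r m B → G.Adj y z → (oClosure G).Adj q r)
    (hpy : G.Adj p y) (hyz : G.Adj y z) : y = x := by
  by_contra hyx
  have hle := le_oClosure G
  by_cases hy : y ∈ S
  · have hym : y ≠ m := by
      rintro rfl
      exact hS.not_adj_of_succ hz hp.reverse hxp.symm hxz (hle hyz)
    obtain ⟨q, A, r, B, h⟩ :=
      TwoArcs.exists_of_path hp hx hxp hmx hy hyx hpy.ne.symm hym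
    exact hS.false_of_exists hz ((h.mono hle).exists_cycleOn_of_chord hz (hle hxz)
      (hle hyz.symm) (hsucc y q A r B h hyz) (hle hpy))
  · have hyp : y ∉ S.erase x := fun h => hy (Finset.mem_of_mem_erase h)
    refine hS.false_of_exists hz ⟨_, ?_, ?_, .of_path (.cons (hle hyz).symm
      (.cons (hle hpy).symm (hp.mono hle) hyp) ?_) ?_ ?_ (hle hxz) (hle hmx)⟩
    · intro t ht
      by_cases htx : t = x <;> simp [htx, ht]
    · simp
    · simp [hyz.ne.symm, hz]
    · simp [hxz.ne, Ne.symm hyx]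
    · rintro rfl
      exact hz (Finset.mem_of_mem_erase hp.right_mem)

/-- In an o-heavy graph the two cycle neighbours of an attachment vertex are o-adjacent. -/
theorem MaximalCycleOn.adj_of_oHeavy (hS : MaximalCycleOn G S) (hG : OHeavy G) (hz : z ∉ S)
    (hp : PathOn G p m (S.erase x)) (hxp : G.Adj x p) (hmx : G.Adj m x)
    (hpm : p ≠ m) (hxz : G.Adj x z) : (oClosure G).Adj p m := by
  refine ⟨hpm, ?_⟩
  by_contra! hcon
  have hpz := hS.not_adj_of_succ hz hp hmx hxz
  have hmz := hS.not_adj_of_succ hz hp.reverse hxp.symm hxz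
  have hpz' : p ≠ z := by
    rintro rfl
    exact hz (Finset.mem_of_mem_erase hp.left_mem)
  have hmz' : m ≠ z := by
    rintro rfl
    exact hz (Finset.mem_of_mem_erase hp.right_mem)
  obtain h | h | h := hG x p m z ⟨hpm, hpz', hmz', hxp, hmx.symm, hxz, hcon.1,
    fun h => hpz (le_oClosure G h), fun h => hmz (le_oClosure G h)⟩
  · exact absurd h hcon.2.not_ge
  · exact hpz ⟨hpz', Or.inr h⟩
  · exact hmz ⟨hmz', Or.inr h⟩

theorem MaximalCycleOn.heavy_of_fanOrShi (hS : MaximalCycleOn G S) (hG : OHeavy G)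
    (hheavy : ∀ v, Heavy G v → v ∈ S) (hz : z ∉ S)
    (hx : x ∈ S) (hp : PathOn G p m (S.erase x)) (hxp : G.Adj x p) (hmx : G.Adj m x)
    (hxz : G.Adj x z) (h : FanOrShi G p z) : Heavy G p := by
  obtain h | h | h := h
  · exact h
  · exact absurd (hheavy z h) hz
  · exfalso
    obtain ⟨y, hy, hyx⟩ := Finset.exists_mem_ne (Nat.lt_of_succ_le h) x
    simp only [Finset.mem_inter, mem_neighborFinset] at hy
    refine hyx (hS.eq_of_common_adj hz hx hp hxp hmx hxz ?_ hy.1 hy.2.symm)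
    intro y q A r B harcs hyz
    have h' := harcs.symm
    exact (hS.adj_of_oHeavy hG hz h'.path_erase h'.adj_xp h'.adj_mx
      h'.ends_ne hyz).symm

theorem MaximalCycleOn.le_degree_add_degree (hS : MaximalCycleOn G S) (hG : OHeavy G)
    (hheavy : ∀ v, Heavy G v → v ∈ S)
    (h : ∀ a1 a2 a3 b1 : V, IsInducedZ1 G a1 a2 a3 b1 → FanOrShi G a2 b1 ∧ FanOrShi G a3 b1)
    (hz : z ∉ S) (hx : x ∈ S) (hp : PathOn G p m (S.erase x)) (hxp : G.Adj x p)
    (hmx : G.Adj m x) (hpm : p ≠ m) (hxz : G.Adj x z) :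
    Fintype.card V ≤ G.degree p + G.degree m := by
  obtain ⟨-, hadj | hdeg⟩ := hS.adj_of_oHeavy hG hz hp hxp hmx hpm hxz
  · have hpz := hS.not_adj_of_succ hz hp hmx hxz
    have hmz := hS.not_adj_of_succ hz hp.reverse hxp.symm hxz
    obtain ⟨h1, h2⟩ := h x p m z ⟨hxp, hmx.symm, hadj, hxz,
      fun h => hz (h ▸ Finset.mem_of_mem_erase hp.left_mem),
      fun h => hz (h ▸ Finset.mem_of_mem_erase hp.right_mem),
      fun h => hpz (le_oClosure G h.symm), fun h => hmz (le_oClosure G h.symm)⟩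
    have h1' := hS.heavy_of_fanOrShi hG hheavy hz hx hp hxp hmx hxz h1
    have h2' := hS.heavy_of_fanOrShi hG hheavy hz hx hp.reverse hmx.symm hxp.symm hxz h2
    unfold Heavy at h1' h2'
    omega
  · exact hdeg

end MaximalCycle

/-- In a 2-connected graph, two distinct vertices of a set `S` are joined by a path
through the complement of `S`. -/
theorem TwoConnected.exists_bridge {V : Type*} [Fintype V] [DecidableEq V] {G : SimpleGraph V}
    {S : Finset V} (h2 : TwoConnected G) (hS : 1 < S.card) (hne : S ≠ Finset.univ) :
    ∃ x y z w Z, x ∈ S ∧ y ∈ S ∧ x ≠ y ∧ PathOn G z w Z ∧ Disjoint Z S ∧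
      G.Adj x z ∧ G.Adj w y := by
  obtain ⟨z₀, hz₀⟩ : ∃ z, z ∉ S := by
    by_contra! hcon
    exact hne (Finset.eq_univ_of_forall hcon)
  have key : ∀ z ∉ S, ∀ x ∈ S, ∃ w y Z, PathOn G z w Z ∧ Disjoint Z S ∧ y ∈ S ∧ y ≠ x ∧
      G.Adj w y := by
    intro z hz x hx
    obtain ⟨t, ht, htx⟩ := Finset.exists_mem_ne hS x
    obtain ⟨T, hT, hxT⟩ := h2.exists_path (a := z) (b := t) (fun h => hz (h ▸ hx)) htx
    obtain ⟨w, y, Z, hZ, hd, -, hyT, hyS, hwy⟩ := hT.exists_first_mem hz ht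
    exact ⟨w, y, Z, hZ, hd, hyS, fun h => hxT (h ▸ hyT), hwy⟩
  obtain ⟨s, hs⟩ := Finset.card_pos.mp (Nat.zero_lt_of_lt hS)
  obtain ⟨z, x, Z₀, hZ₀, hd₀, hx, -, hzx⟩ := key z₀ hz₀ s hs
  obtain ⟨w, y, Z, hZ, hd, hy, hyx, hwy⟩ :=
    key z (Finset.disjoint_left.mp hd₀ hZ₀.right_mem) x hx
  exact ⟨x, y, z, w, Z, hx, hy, hyx.symm, hZ, hd, hzx.symm, hwy⟩

/-- **Chen–Zhang–Qiao theorem.** Let `G` be a 2-connected o-heavy graph. If every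
pair of vertices at distance 2 within an induced copy `H` of `Z₁` (namely the
pairs `{a₂,b₁}` and `{a₃,b₁}`) satisfies Fan's or Shi's condition in `G`, then
`G` is Hamiltonian. -/
theorem chen_zhang_qiao {V : Type*} [Fintype V] [DecidableEq V]
    (G : SimpleGraph V) [DecidableRel G.Adj]
    (h2 : TwoConnected G)
    (hheavy : OHeavy G)
    (h : ∀ a1 a2 a3 b1 : V, IsInducedZ1 G a1 a2 a3 b1 →
      FanOrShi G a2 b1 ∧ FanOrShi G a3 b1) :
    G.IsHamiltonian := by
  obtain ⟨S, hcyc, hmem, hmax⟩ := h2.exists_maximal_cycleOn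
  have hS : MaximalCycleOn G S := ⟨hcyc, hmax⟩
  by_cases huniv : S = Finset.univ
  · subst huniv
    exact hcyc.isHamiltonian
  exfalso
  have hle := le_oClosure G
  obtain ⟨x, y, z, w, Z, hx, hy, hxy, hZ, hd, hxz, hwy⟩ :=
    h2.exists_bridge (by have := hcyc.1; omega) huniv
  have hz := Finset.disjoint_left.mp hd hZ.left_mem
  have hw := Finset.disjoint_left.mp hd hZ.right_mem
  obtain ⟨p, m, hpm, hxp, hmx, hne⟩ := hcyc.exists_path_erase hx
  -- a path through `Z` between consecutive vertices of the cycle would extend it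
  have hins : ∀ p m, PathOn G p m (S.erase x) → G.Adj m x → y ≠ p := by
    rintro p m hpm hmx rfl
    have hdx : Disjoint Z (S.erase x) := hd.mono_right (Finset.erase_subset _ _)
    have hpath := hZ.append hpm hwy hdx
    refine hS.false_of_exists hz ⟨_, ?_, ?_, (CycleOn.of_path hpath ?_ ?_ hxz hmx).mono hle⟩
    · intro t ht
      by_cases htx : t = x <;> simp [htx, ht]
    · simp [hZ.left_mem]
    · simp [Finset.disjoint_right.mp hd hx]
    · rintro rfl
      exact hz (Finset.mem_of_mem_erase hpm.right_mem)
  obtain ⟨q, A, r, B, harcs⟩ := TwoArcs.exists_of_path hpm hx hxp hmx hy hxy.symm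
    (hins p m hpm hmx) (hins m p hpm.reverse hxp.symm)
  have hnadj : ∀ {p q A r m B}, TwoArcs G S x p q A y r m B → ¬(oClosure G).Adj p r :=
    fun h hpr => hS.false_of_exists hz ((h.mono hle).exists_cycleOn_of_starts_adj (hZ.mono hle) hd
      (hle hxz) (hle hwy) hpr)
  have hdegx := hS.le_degree_add_degree hheavy hmem h hz hx hpm hxp hmx hne hxz
  have hdegy := hS.le_degree_add_degree hheavy hmem h hw hy harcs.symm.path_erase harcs.adj_yr
    harcs.adj_qy harcs.symm.ends_ne hwy.symm
  have hpr : G.degree p + G.degree r < Fintype.card V := by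
    by_contra! hcon
    exact hnadj harcs ⟨harcs.starts_ne, Or.inr hcon⟩
  have hmq : G.degree m + G.degree q < Fintype.card V := by
    by_contra! hcon
    exact hnadj harcs.reverse ⟨harcs.reverse.starts_ne, Or.inr hcon⟩
  omega
end
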